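/- arXiv:1510.00691 — 2 statements merged into one kernel-verified Lean document; each statement's English description precedes it below -/
import Mathlib

section
/- Looping lemma for transfinite tape evolutions: Suppose f : ℕ → Ordinal → Bool is a family of cell-value functions obeying the lim-sup rule at countable limit stages, i.e., for every i and every limit ordinal λ < ω₁, f i λ = true if and only if for every γ < λ there exists δ with γ ≤ δ < λ and f i δ = true. Then there exists an ordinal α < ω₁ whose configuration recurs unboundedly below ω₁: for every β < ω₁ there exists β' with β ≤ β' < ω₁ such that f i β' = f i α for every i. (This is the paper's claim that every non-halting infinite time Turing machine computation reaches, already at some countable stage, a snapshot that repeats unboundedly often beneath ℵ₁.) -/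
open Ordinal Cardinal

/-- The first uncountable ordinal. -/
noncomputable def omega1 : Ordinal := (Cardinal.aleph 1).ord

theorem omega1_eq_omega_one : omega1 = ω₁ := Cardinal.ord_aleph 1

theorem iSup_nat_lt_omega1 {g : ℕ → Ordinal} (hg : ∀ n, g n < omega1) : ⨆ n, g n < omega1 := by
  rw [omega1_eq_omega_one] at *
  exact Ordinal.iSup_lt_omega_one hg

theorem succ_lt_omega1 {a : Ordinal} (ha : a < omega1) : Order.succ a < omega1 := by
  rw [omega1_eq_omega_one] at *
  exact (Cardinal.isSuccLimit_omega 1).succ_lt ha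

theorem isSuccLimit_iSup_of_strictMono {g : ℕ → Ordinal} (hg : StrictMono g) :
    Order.IsSuccLimit (⨆ n, g n) := by
  have hlt (n : ℕ) : g n < ⨆ n, g n :=
    (hg n.lt_succ_self).trans_le (Ordinal.le_iSup g (n + 1))
  refine ⟨(hlt 0).not_isMin, Order.isSuccPrelimit_of_succ_lt fun a ha => ?_⟩
  obtain ⟨n, hn⟩ := Ordinal.lt_iSup_iff.1 ha
  exact (Order.succ_le_of_lt hn).trans_lt (hlt n)

/-- A cell shows `true` unboundedly often below `ω₁`. -/
def UnboundedlyTrue (p : Ordinal → Bool) : Prop :=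
  ∀ γ < omega1, ∃ δ, γ ≤ δ ∧ δ < omega1 ∧ p δ = true

/-- Beyond some countable stage, every cell which is not unboundedly often `true` is `false`. -/
theorem exists_eventually_false (f : ℕ → Ordinal → Bool) :
    ∃ B < omega1, ∀ i, ¬ UnboundedlyTrue (f i) → ∀ δ, B ≤ δ → δ < omega1 → f i δ = false := by
  have h (i : ℕ) : ∃ b < omega1, ¬ UnboundedlyTrue (f i) →
      ∀ δ, b ≤ δ → δ < omega1 → f i δ = false := by
    by_cases hi : UnboundedlyTrue (f i)
    · exact ⟨0, by simp [omega1_eq_omega_one, Ordinal.omega_pos], fun h => absurd hi h⟩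
    · have hi' := hi
      simp only [UnboundedlyTrue, not_forall, not_exists, not_and, Bool.not_eq_true] at hi'
      obtain ⟨b, hb, hfalse⟩ := hi'
      exact ⟨b, hb, fun _ => hfalse⟩
  choose b hb hfalse using h
  exact ⟨⨆ i, b i, iSup_nat_lt_omega1 hb, fun i hi δ hδ =>
    hfalse i hi δ ((Ordinal.le_iSup b i).trans hδ)⟩

/-- There is a map on countable stages which passes a `true` value of each cell that is unboundedly
often `true`. -/
theorem exists_step (f : ℕ → Ordinal → Bool) :
    ∃ N : Ordinal → Ordinal, (∀ γ, γ < N γ) ∧ (∀ γ < omega1, N γ < omega1) ∧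
      ∀ γ < omega1, ∀ i, UnboundedlyTrue (f i) → ∃ δ, γ ≤ δ ∧ δ < N γ ∧ f i δ = true := by
  have h (i : ℕ) (γ : Ordinal) : ∃ δ, γ ≤ δ ∧ (γ < omega1 → δ < omega1) ∧
      (γ < omega1 → UnboundedlyTrue (f i) → f i δ = true) := by
    by_cases hi : γ < omega1 ∧ UnboundedlyTrue (f i)
    · obtain ⟨δ, h₁, h₂, h₃⟩ := hi.2 γ hi.1
      exact ⟨δ, h₁, fun _ => h₂, fun _ _ => h₃⟩
    · exact ⟨γ, le_rfl, id, fun h₁ h₂ => absurd ⟨h₁, h₂⟩ hi⟩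
  choose s hle hlt htrue using h
  refine ⟨fun γ => Order.succ (⨆ i, s i γ), fun γ => ?_, fun γ hγ => ?_, fun γ hγ i hi => ?_⟩
  · exact Order.lt_succ_of_le ((hle 0 γ).trans (Ordinal.le_iSup (s · γ) 0))
  · exact succ_lt_omega1 (iSup_nat_lt_omega1 fun i => hlt i γ hγ)
  · exact ⟨s i γ, hle i γ, Order.lt_succ_of_le (Ordinal.le_iSup (s · γ) i), htrue i γ hγ hi⟩

/-- The configuration in which exactly the unboundedly often `true` cells are `true` is attained
unboundedly often. -/
theorem exists_eq_true_iff_unboundedlyTrue (f : ℕ → Ordinal → Bool)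
    (hlim : ∀ i : ℕ, ∀ l : Ordinal, l < omega1 → Order.IsSuccLimit l →
      (f i l = true ↔ ∀ γ < l, ∃ δ, γ ≤ δ ∧ δ < l ∧ f i δ = true))
    {β : Ordinal} (hβ : β < omega1) :
    ∃ l, β ≤ l ∧ l < omega1 ∧ ∀ i, f i l = true ↔ UnboundedlyTrue (f i) := by
  obtain ⟨B, hB, hfalse⟩ := exists_eventually_false f
  obtain ⟨N, hlt, hN, htrue⟩ := exists_step f
  let g (n : ℕ) : Ordinal := N^[n] (max β B)
  have hsucc (n : ℕ) : g (n + 1) = N (g n) := Function.iterate_succ_apply' N n _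
  have hg (n : ℕ) : g n < omega1 := by
    induction n with
    | zero => exact max_lt hβ hB
    | succ n ih => rw [hsucc]; exact hN _ ih
  have hmono : StrictMono g := strictMono_nat_of_lt_succ fun n => by rw [hsucc]; exact hlt _
  have h0 : max β B ≤ ⨆ n, g n := Ordinal.le_iSup g 0
  have hl := iSup_nat_lt_omega1 hg
  refine ⟨⨆ n, g n, (le_max_left _ _).trans h0, hl, fun i => ⟨fun h => ?_, fun h => ?_⟩⟩
  · by_contra hi
    simp [hfalse i hi _ ((le_max_right _ _).trans h0) hl] at h
  · refine (hlim i _ hl (isSuccLimit_iSup_of_strictMono hmono)).2 fun γ hγ => ?_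
    obtain ⟨n, hn⟩ := Ordinal.lt_iSup_iff.1 hγ
    obtain ⟨δ, h₁, h₂, h₃⟩ := htrue (g n) (hg n) i h
    rw [← hsucc] at h₂
    exact ⟨δ, hn.le.trans h₁, h₂.trans_le (Ordinal.le_iSup g (n + 1)), h₃⟩

/-- Looping lemma for transfinite tape evolutions: if a family of cell-value
functions obeys the lim-sup rule at countable limit stages, then some countable
stage has a configuration that recurs unboundedly below `ω₁`. -/
theorem looping_lemma (f : ℕ → Ordinal → Bool)
    (hlim : ∀ i : ℕ, ∀ l : Ordinal, l < omega1 → Order.IsSuccLimit l →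
      (f i l = true ↔ ∀ γ < l, ∃ δ, γ ≤ δ ∧ δ < l ∧ f i δ = true)) :
    ∃ α, α < omega1 ∧ ∀ β < omega1, ∃ β', β ≤ β' ∧ β' < omega1 ∧
      ∀ i : ℕ, f i β' = f i α := by
  have hpos : (0 : Ordinal) < omega1 := by simp [omega1_eq_omega_one, Ordinal.omega_pos]
  obtain ⟨α, -, hα, hαf⟩ := exists_eq_true_iff_unboundedlyTrue f hlim hpos
  refine ⟨α, hα, fun β hβ => ?_⟩
  obtain ⟨l, hβl, hl, hlf⟩ := exists_eq_true_iff_unboundedlyTrue f hlim hβ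
  exact ⟨l, hβl, hl, fun i => Bool.eq_iff_iff.2 ((hlf i).trans (hαf i).symm)⟩
end

section
/- Snapshot repetition for non-halting computations: Suppose f : ℕ → Ordinal → Bool is a family of cell-value functions obeying the lim-sup rule at countable limit stages, i.e., for every i and every limit ordinal λ < ω₁, f i λ = true if and only if for every γ < λ there exists δ with γ ≤ δ < λ and f i δ = true. Then there exist ordinals α < β, both less than ω₁, such that f i α = f i β for every i. (This is the paper's claim that a computation that never halts must repeat a snapshot already at countable stages.) -/
open Ordinal Cardinal

/-- A step function on countable ordinals, iterated from any countable starting point through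
countably many coordinates, reaches a countable limit closed under all coordinates. -/
theorem exists_isSuccLimit_closed (g : ℕ → Ordinal → Ordinal)
    (hg : ∀ i, ∀ γ < omega1, g i γ < omega1) (ξ : Ordinal) (hξ : ξ < omega1) :
    ∃ α, ξ < α ∧ α < omega1 ∧ Order.IsSuccLimit α ∧
      ∀ γ < α, ∃ η, γ ≤ η ∧ η < α ∧ ∀ i, g i η < α := by
  have homega : omega1 = ω_ 1 := Cardinal.ord_aleph 1
  rw [homega] at hg hξ ⊢
  have hsucc : ∀ a < ω_ 1, Order.succ a < ω_ 1 := fun a ha =>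
    (isSuccLimit_omega 1).succ_lt ha
  let s : ℕ → Ordinal := fun n =>
    Nat.rec ξ (fun _ a => Order.succ (max a (⨆ i, g i a))) n
  have hs_succ : ∀ n, s (n + 1) = Order.succ (max (s n) (⨆ i, g i (s n))) := fun _ => rfl
  have hs : ∀ n, s n < ω_ 1 := by
    intro n
    induction n with
    | zero => exact hξ
    | succ n ih =>
      rw [hs_succ]
      exact hsucc _ (max_lt ih (Ordinal.iSup_lt_omega_one fun i => hg i _ ih))
  have hlt : ∀ n, s n < s (n + 1) := fun n => by
    rw [hs_succ, Order.lt_succ_iff]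
    exact le_max_left _ _
  have hle : ∀ n, s n ≤ ⨆ n, s n := fun n => Ordinal.le_iSup s n
  have hlt_sup : ∀ n, s n < ⨆ n, s n := fun n => (hlt n).trans_le (hle (n + 1))
  refine ⟨⨆ n, s n, hlt_sup 0, Ordinal.iSup_lt_omega_one hs, ?_, ?_⟩
  · refine ⟨fun h => (hlt_sup 0).not_ge (h (hlt_sup 0).le), ?_⟩
    refine Order.isSuccPrelimit_of_succ_lt fun a ha => ?_
    obtain ⟨n, hn⟩ := Ordinal.lt_iSup_iff.1 ha
    exact (Order.succ_le_of_lt hn).trans_lt (hlt_sup n)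
  · intro γ hγ
    obtain ⟨n, hn⟩ := Ordinal.lt_iSup_iff.1 hγ
    refine ⟨s n, hn.le, hlt_sup n, fun i => lt_of_lt_of_le ?_ (hle (n + 1))⟩
    rw [hs_succ, Order.lt_succ_iff]
    exact (Ordinal.le_iSup (fun i => g i (s n)) i).trans (le_max_right _ _)

/-- Above every countable ordinal there is a countable stage whose snapshot records exactly the
cells that are true cofinally often in `omega1`. -/
theorem exists_stage_eq_true_iff_cofinally (f : ℕ → Ordinal → Bool)
    (hlim : ∀ i : ℕ, ∀ l : Ordinal, l < omega1 → Order.IsSuccLimit l →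
      (f i l = true ↔ ∀ γ < l, ∃ δ, γ ≤ δ ∧ δ < l ∧ f i δ = true))
    (ξ : Ordinal) (hξ : ξ < omega1) :
    ∃ α, ξ < α ∧ α < omega1 ∧
      ∀ i, f i α = true ↔ ∀ γ < omega1, ∃ δ, γ ≤ δ ∧ δ < omega1 ∧ f i δ = true := by
  have hstep : ∀ i γ, ∃ δ, γ < omega1 → γ ≤ δ ∧ δ < omega1 ∧
      ((∀ γ < omega1, ∃ δ, γ ≤ δ ∧ δ < omega1 ∧ f i δ = true) ∧ f i δ = true ∨
        ∀ ε, δ ≤ ε → ε < omega1 → f i ε ≠ true) := by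
    intro i γ
    by_cases hγ : γ < omega1
    · by_cases hc : ∀ γ < omega1, ∃ δ, γ ≤ δ ∧ δ < omega1 ∧ f i δ = true
      · obtain ⟨δ, h1, h2, h3⟩ := hc γ hγ
        exact ⟨δ, fun _ => ⟨h1, h2, Or.inl ⟨hc, h3⟩⟩⟩
      · push Not at hc
        obtain ⟨b, hb, hb'⟩ := hc
        exact ⟨max γ b, fun _ => ⟨le_max_left _ _, max_lt hγ hb,
          Or.inr fun ε h1 h2 => hb' ε ((le_max_right _ _).trans h1) h2⟩⟩
    · exact ⟨γ, fun h => absurd h hγ⟩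
  choose g hg using hstep
  obtain ⟨α, hξα, hα, hαlim, hclosed⟩ :=
    exists_isSuccLimit_closed g (fun i γ hγ => (hg i γ hγ).2.1) ξ hξ
  refine ⟨α, hξα, hα, fun i => ⟨fun h => ?_, fun hc => (hlim i α hα hαlim).2 fun γ hγ => ?_⟩⟩
  · obtain ⟨η, -, hη, hgη⟩ := hclosed ξ hξα
    obtain ⟨-, -, hc | hn⟩ := hg i η (hη.trans hα)
    · exact hc.1
    · exact absurd h (hn α (hgη i).le hα)
  · obtain ⟨η, hγη, hη, hgη⟩ := hclosed γ hγ
    obtain ⟨hle, hlt, ht | hn⟩ := hg i η (hη.trans hα)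
    · exact ⟨g i η, hγη.trans hle, hgη i, ht.2⟩
    · obtain ⟨δ, h1, h2, h3⟩ := hc _ hlt
      exact absurd h3 (hn δ h1 h2)

/-- Snapshot repetition: if a family of cell-value functions obeys the lim-sup
rule at countable limit stages, then some snapshot repeats already at countable
stages. -/
theorem snapshot_repetition (f : ℕ → Ordinal → Bool)
    (hlim : ∀ i : ℕ, ∀ l : Ordinal, l < omega1 → Order.IsSuccLimit l →
      (f i l = true ↔ ∀ γ < l, ∃ δ, γ ≤ δ ∧ δ < l ∧ f i δ = true)) :
    ∃ α β : Ordinal, α < β ∧ β < omega1 ∧ ∀ i : ℕ, f i α = f i β := by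
  have hpos : (0 : Ordinal) < omega1 := by
    unfold omega1
    exact Cardinal.isRegular_aleph_one.ord_pos
  obtain ⟨α, -, hα, hfα⟩ := exists_stage_eq_true_iff_cofinally f hlim 0 hpos
  obtain ⟨β, hαβ, hβ, hfβ⟩ := exists_stage_eq_true_iff_cofinally f hlim α hα
  exact ⟨α, β, hαβ, hβ, fun i => Bool.eq_iff_iff.2 ((hfα i).trans (hfβ i).symm)⟩
end
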